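/- Let p be a transition kernel on a finite MDP whose state space contains a distinguished state z that is absorbing under p (p_{z,a} = 1_z for every action a), let s ≠ z be a state, μ₁ an initial distribution, and d ≥ 1 a horizon. Then for every (possibly non-stationary) deterministic policy π: X_d^π({s}, p, μ₁) ≥ X_d^π({s}, cut(p), μ₁) − W_d^π(1_z, p, μ₁), i.e., the probability of reaching s within d steps under p is at least the probability of reaching s within d steps under cut(p) minus the expected number of visits to z within d steps under p. -/

import Mathlib

open scoped Classical BigOperators

/-- `val p r d π s` is the expected total reward `E[Σ_{h=1}^d r(s_h,a_h)]` collected in `d`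
steps, following the (possibly non-stationary) deterministic policy `π` under the transition
kernel `p`, starting from state `s`. -/
noncomputable def val {S A : Type*} [Fintype S] (p : S → A → S → ℝ)
    (r : S → A → ℝ) : ℕ → (ℕ → S → A) → S → ℝ
  | 0, _, _ => 0
  | d + 1, π, s =>
      r s (π 0 s) + ∑ s' : S, p s (π 0 s) s' * val p r d (fun h => π (h + 1)) s'

/-- `reachS p s d π s₀`: the probability of reaching the state `s` within `d` steps,
following the (possibly non-stationary) deterministic policy `π` under `p`, from `s₀`. -/
noncomputable def reachS {S A : Type*} [Fintype S] (p : S → A → S → ℝ) (s : S) :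
    ℕ → (ℕ → S → A) → S → ℝ
  | 0, _, _ => 0
  | d + 1, π, s₀ =>
      if s₀ = s then 1
      else ∑ s' : S, p s₀ (π 0 s₀) s' * reachS p s d (fun h => π (h + 1)) s'

/-- The `cut` transition model: for `(s,a)` with `p_{s,a,z} < 1`, renormalize the row away
from `z`; for `(s,a)` with `p_{s,a,z} = 1`, keep the Dirac row at `z`. -/
noncomputable def cutKer {S A : Type*} (p : S → A → S → ℝ) (z : S) : S → A → S → ℝ :=
  fun s a s' =>
    if p s a z = 1 then (if s' = z then 1 else 0)
    else if s' = z then 0 else p s a s' / (1 - p s a z)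

/-- The reward `1_z` equal to `1` exactly on the state `z`. -/
noncomputable def indState {S A : Type*} (z : S) : S → A → ℝ :=
  fun s' _ => if s' = z then 1 else 0

theorem indState_nonneg {S A : Type*} (z s : S) (a : A) : 0 ≤ indState z s a := by
  unfold indState
  split_ifs
  exacts [zero_le_one, le_rfl]

section Kernel

variable {S A : Type*} [Fintype S] {p : S → A → S → ℝ}

theorem le_one_of_sum_eq_one (hp0 : ∀ s a s', 0 ≤ p s a s') (hp1 : ∀ s a, ∑ s' : S, p s a s' = 1)
    (s : S) (a : A) (s' : S) : p s a s' ≤ 1 :=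
  (Finset.single_le_sum (fun x _ => hp0 s a x) (Finset.mem_univ s')).trans_eq (hp1 s a)

theorem cutKer_nonneg (hp0 : ∀ s a s', 0 ≤ p s a s') (hp1 : ∀ s a, ∑ s' : S, p s a s' = 1)
    (z s : S) (a : A) (s' : S) : 0 ≤ cutKer p z s a s' := by
  have := le_one_of_sum_eq_one hp0 hp1 s a z
  unfold cutKer
  split_ifs
  · exact zero_le_one
  · exact le_rfl
  · exact le_rfl
  · exact div_nonneg (hp0 s a s') (sub_nonneg.2 this)

theorem sum_cutKer (hp1 : ∀ s a, ∑ s' : S, p s a s' = 1) (z s : S) (a : A) :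
    ∑ s' : S, cutKer p z s a s' = 1 := by
  by_cases hq : p s a z = 1
  · simp [cutKer, hq]
  · have hq' : 1 - p s a z ≠ 0 := sub_ne_zero.2 (Ne.symm hq)
    have h (s' : S) : cutKer p z s a s' =
        (p s a s' - if s' = z then p s a z else 0) / (1 - p s a z) := by
      by_cases hz : s' = z <;> simp [cutKer, hq, hz]
    simp only [h]
    rw [← Finset.sum_div, Finset.sum_sub_distrib, hp1, Finset.sum_ite_eq' Finset.univ z]
    simp [hq']

/-- Averaging under the cut kernel is dominated by averaging under the original kernel, for
functions `f ≤ g` such that `g z` dominates all of `f`. -/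
theorem sum_cutKer_mul_le (hp0 : ∀ s a s', 0 ≤ p s a s') (hp1 : ∀ s a, ∑ s' : S, p s a s' = 1)
    (z : S) {f g : S → ℝ} (hfg : ∀ s', f s' ≤ g s') (hg : ∀ s', 0 ≤ g s')
    (hfz : ∀ s', f s' ≤ g z) (s : S) (a : A) :
    ∑ s' : S, cutKer p z s a s' * f s' ≤ ∑ s' : S, p s a s' * g s' := by
  have term (s' : S) : cutKer p z s a s' * f s' ≤
      (p s a s' * g s' - if s' = z then p s a z * g z else 0) +
        cutKer p z s a s' * (p s a z * g z) := by
    by_cases hq : p s a z = 1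
    · by_cases hz : s' = z
      · simpa [cutKer, hq, hz] using hfz z
      · simpa [cutKer, hq, hz] using mul_nonneg (hp0 s a s') (hg s')
    · by_cases hz : s' = z
      · simp [cutKer, hq, hz]
      · have hq' : 1 - p s a z ≠ 0 := sub_ne_zero.2 (Ne.symm hq)
        have hc : cutKer p z s a s' * (1 - p s a z) = p s a s' := by
          simp [cutKer, hq, hz, hq']
        have h₁ := mul_le_mul_of_nonneg_left (hfg s') (hp0 s a s')
        have h₂ := mul_le_mul_of_nonneg_left (hfz s')
          (mul_nonneg (cutKer_nonneg hp0 hp1 z s a s') (hp0 s a z))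
        rw [if_neg hz]
        linear_combination h₁ + h₂ + f s' * hc
  calc ∑ s' : S, cutKer p z s a s' * f s'
      ≤ ∑ s' : S, ((p s a s' * g s' - if s' = z then p s a z * g z else 0) +
          cutKer p z s a s' * (p s a z * g z)) := Finset.sum_le_sum fun s' _ => term s'
    _ = ∑ s' : S, p s a s' * g s' := by
      rw [Finset.sum_add_distrib, Finset.sum_sub_distrib, ← Finset.sum_mul, sum_cutKer hp1,
        Finset.sum_ite_eq' Finset.univ z]
      simp

theorem val_nonneg (hp0 : ∀ s a s', 0 ≤ p s a s') {r : S → A → ℝ} (hr : ∀ s a, 0 ≤ r s a)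
    (d : ℕ) (π : ℕ → S → A) (s : S) : 0 ≤ val p r d π s := by
  induction d generalizing π s with
  | zero => exact le_rfl
  | succ d ih =>
    exact add_nonneg (hr _ _) (Finset.sum_nonneg fun s' _ => mul_nonneg (hp0 _ _ _) (ih _ s'))

theorem reachS_nonneg (hp0 : ∀ s a s', 0 ≤ p s a s') (s : S) (d : ℕ) (π : ℕ → S → A) (s₀ : S) :
    0 ≤ reachS p s d π s₀ := by
  induction d generalizing π s₀ with
  | zero => exact le_rfl
  | succ d ih =>
    rw [reachS]
    split_ifs
    · exact zero_le_one
    · exact Finset.sum_nonneg fun s' _ => mul_nonneg (hp0 _ _ _) (ih _ s')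

theorem reachS_le_one (hp0 : ∀ s a s', 0 ≤ p s a s') (hp1 : ∀ s a, ∑ s' : S, p s a s' = 1)
    (s : S) (d : ℕ) (π : ℕ → S → A) (s₀ : S) : reachS p s d π s₀ ≤ 1 := by
  induction d generalizing π s₀ with
  | zero => exact zero_le_one
  | succ d ih =>
    rw [reachS]
    split_ifs
    · exact le_rfl
    · exact (Finset.sum_le_sum fun s' _ => mul_le_of_le_one_right (hp0 _ _ s') (ih _ s')).trans_eq
        (hp1 _ _)

theorem reachS_cutKer_le_val (hp0 : ∀ s a s', 0 ≤ p s a s')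
    (hp1 : ∀ s a, ∑ s' : S, p s a s' = 1) (z s : S) (d : ℕ) (π : ℕ → S → A) (s₀ : S) :
    reachS (cutKer p z) s d π s₀ ≤ val p (indState z) d π z := by
  cases d with
  | zero => exact le_rfl
  | succ d =>
    refine (reachS_le_one (cutKer_nonneg hp0 hp1 z) (sum_cutKer hp1 z) s _ π s₀).trans ?_
    rw [val, indState, if_pos rfl]
    exact le_add_of_nonneg_right (Finset.sum_nonneg fun s' _ =>
      mul_nonneg (hp0 _ _ _) (val_nonneg hp0 (indState_nonneg z) d _ s'))

theorem reachS_cutKer_le (hp0 : ∀ s a s', 0 ≤ p s a s')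
    (hp1 : ∀ s a, ∑ s' : S, p s a s' = 1) (z s : S) (d : ℕ) (π : ℕ → S → A) (s₀ : S) :
    reachS (cutKer p z) s d π s₀ ≤ reachS p s d π s₀ + val p (indState z) d π s₀ := by
  induction d generalizing π s₀ with
  | zero => simp [reachS, val]
  | succ d ih =>
    have hv := val_nonneg hp0 (indState_nonneg (A := A) z)
    have hx := reachS_nonneg hp0 s
    by_cases h : s₀ = s
    · have := hv (d + 1) π s₀
      simpa only [reachS, if_pos h, le_add_iff_nonneg_right] using this
    · have key := sum_cutKer_mul_le hp0 hp1 z (ih fun h => π (h + 1))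
        (fun s' => add_nonneg (hx d _ s') (hv d _ s'))
        (fun s' => (reachS_cutKer_le_val hp0 hp1 z s d _ s').trans
          (le_add_of_nonneg_left (hx d _ z))) s₀ (π 0 s₀)
      simp only [mul_add, Finset.sum_add_distrib] at key
      simp only [reachS, if_neg h, val]
      linarith [indState_nonneg z s₀ (π 0 s₀)]

end Kernel

/-- If `z` is absorbing under `p`, then for every (possibly non-stationary) deterministic
policy `π`, state `s ≠ z`, initial distribution `μ₁` and horizon `d ≥ 1`:
`X_d^π({s},p,μ₁) ≥ X_d^π({s},cut(p),μ₁) − W_d^π(1_z,p,μ₁)`. -/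
theorem reach_cut_lower_bound {S A : Type*} [Fintype S] [Fintype A]
    (p : S → A → S → ℝ)
    (hp0 : ∀ s a s', 0 ≤ p s a s') (hp1 : ∀ s a, ∑ s' : S, p s a s' = 1)
    (z : S) (habs : ∀ a s', p z a s' = if s' = z then 1 else 0)
    (s : S) (hs : s ≠ z)
    (μ₁ : S → ℝ) (hμ0 : ∀ s₀, 0 ≤ μ₁ s₀) (hμ1 : ∑ s₀ : S, μ₁ s₀ = 1)
    (d : ℕ) (hd : 1 ≤ d) (π : ℕ → S → A) :
    (∑ s₀ : S, μ₁ s₀ * reachS (cutKer p z) s d π s₀) -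
        (∑ s₀ : S, μ₁ s₀ * val p (indState z) d π s₀) ≤
      ∑ s₀ : S, μ₁ s₀ * reachS p s d π s₀ := by
  rw [sub_le_iff_le_add, ← Finset.sum_add_distrib]
  refine Finset.sum_le_sum fun s₀ _ => ?_
  rw [← mul_add]
  exact mul_le_mul_of_nonneg_left (reachS_cutKer_le hp0 hp1 z s d π s₀) (hμ0 s₀)
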